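/- arXiv:0911.2791 — 3 statements merged into one kernel-verified Lean document; each statement's English description precedes it below -/
import Mathlib

section
/- Let γ : [0, T] → ℝ² be a C² curve with ‖γ′(t)‖ = 1 for all t, and let A(t) := γ(t) × γ′(t) be its areal density. Fix t ∈ [0, T) and for each positive integer n set k_n := ⌊nt/T⌋. Then the (suitably normalized) edge elements of the LLS-sequence of the inscribed broken line with vertices γ(iT/n), i = 0,…,n, converge pointwise to A: lim_{n→∞} (n/T)·(γ(k_n T/n) × γ((k_n + 1)T/n)) = A(t). -/
open Filter Topology Set

/-- Oriented area of the parallelogram spanned by two vectors of the Euclidean plane. -/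
def cross (v w : EuclideanSpace ℝ (Fin 2)) : ℝ := v 0 * w 1 - v 1 * w 0

open Asymptotics in
/-- **Straddle lemma**: the slopes of chords over intervals `[a i, b i]` shrinking to a point `x`
they contain converge to the derivative at `x`. -/
theorem HasDerivAt.tendsto_straddle {E ι : Type*} [NormedAddCommGroup E] [NormedSpace ℝ E]
    {f : ℝ → E} {f' : E} {x : ℝ} (hf : HasDerivAt f f' x) {l : Filter ι} {a b : ι → ℝ}
    (ha : Tendsto a l (𝓝 x)) (hb : Tendsto b l (𝓝 x)) (hax : ∀ᶠ i in l, a i ≤ x)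
    (hxb : ∀ᶠ i in l, x ≤ b i) (hab : ∀ᶠ i in l, a i < b i) :
    Tendsto (fun i => (b i - a i)⁻¹ • (f (b i) - f (a i))) l (𝓝 f') := by
  have hoa : (fun i => f (a i) - f x - (a i - x) • f') =o[l] fun i => b i - a i := by
    refine (hf.isLittleO.comp_tendsto ha).trans_isBigO (.of_bound 1 ?_)
    filter_upwards [hax, hxb] with i h₁ h₂
    simp only [Function.comp_apply, Real.norm_eq_abs, one_mul]
    rw [abs_of_nonpos (by linarith), abs_of_nonneg (by linarith)]
    linarith
  have hob : (fun i => f (b i) - f x - (b i - x) • f') =o[l] fun i => b i - a i := by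
    refine (hf.isLittleO.comp_tendsto hb).trans_isBigO (.of_bound 1 ?_)
    filter_upwards [hax, hxb] with i h₁ h₂
    simp only [Function.comp_apply, Real.norm_eq_abs, one_mul]
    rw [abs_of_nonneg (by linarith), abs_of_nonneg (by linarith)]
    linarith
  have key := (hob.sub hoa).tendsto_inv_smul_nhds_zero.add_const f'
  rw [zero_add] at key
  refine key.congr' ?_
  filter_upwards [hab] with i hi
  have hne : b i - a i ≠ 0 := (sub_pos.2 hi).ne'
  have hsplit : f (b i) - f x - (b i - x) • f' - (f (a i) - f x - (a i - x) • f')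
      = (f (b i) - f (a i)) - (b i - a i) • f' := by module
  rw [hsplit, smul_sub, inv_smul_smul₀ hne, sub_add_cancel]

theorem continuous_cross :
    Continuous fun p : EuclideanSpace ℝ (Fin 2) × EuclideanSpace ℝ (Fin 2) => cross p.1 p.2 := by
  unfold cross
  fun_prop

theorem cross_smul_sub_self (c : ℝ) (v w : EuclideanSpace ℝ (Fin 2)) :
    cross v (c • (w - v)) = c * cross v w := by
  simp only [cross, PiLp.smul_apply, PiLp.sub_apply, smul_eq_mul]
  ring

/-- **Convergence of edge elements of inscribed broken lines to the areal density.**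
Let `γ : [0,T] → ℝ²` be a unit-speed `C²` curve with areal density `A t = γ t × γ' t`.
For `t ∈ [0,T)` and `kₙ = ⌊n t / T⌋`, the normalized edge elements of the LLS-sequence of
the inscribed broken line with vertices `γ (i T / n)` converge to `A t`:
`(n/T) · (γ (kₙ T / n) × γ ((kₙ+1) T / n)) → A t`. -/
theorem edge_elements_tendsto_areal_density
    (T : ℝ) (hT : 0 < T) (γ γ' γ'' : ℝ → EuclideanSpace ℝ (Fin 2))
    (hγ : ∀ t ∈ Icc 0 T, HasDerivAt γ (γ' t) t)
    (hγ' : ∀ t ∈ Icc 0 T, HasDerivAt γ' (γ'' t) t)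
    (hcont : ContinuousOn γ'' (Icc 0 T))
    (hunit : ∀ t ∈ Icc 0 T, ‖γ' t‖ = 1) :
    ∀ t ∈ Ico 0 T,
      Tendsto (fun n : ℕ =>
          (n / T) * cross (γ ((⌊(n : ℝ) * t / T⌋₊ : ℝ) * T / n))
            (γ (((⌊(n : ℝ) * t / T⌋₊ : ℝ) + 1) * T / n)))
        atTop (𝓝 (cross (γ t) (γ' t))) := by
  intro t ht
  set a : ℕ → ℝ := fun n => (⌊(n : ℝ) * t / T⌋₊ : ℝ) * T / n with ha_def
  set b : ℕ → ℝ := fun n => ((⌊(n : ℝ) * t / T⌋₊ : ℝ) + 1) * T / n with hb_def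
  have hsub (n : ℕ) : b n - a n = T / n := by
    simp only [ha_def, hb_def]
    ring
  have hat : ∀ᶠ n in atTop, a n ≤ t := by
    filter_upwards [eventually_gt_atTop 0] with n hn
    have hn' : (0 : ℝ) < n := Nat.cast_pos.2 hn
    have h := Nat.floor_le (show 0 ≤ (n : ℝ) * t / T from
      div_nonneg (mul_nonneg hn'.le ht.1) hT.le)
    rw [le_div_iff₀ hT] at h
    rw [div_le_iff₀ hn']
    linarith
  have htb : ∀ᶠ n in atTop, t ≤ b n := by
    filter_upwards [eventually_gt_atTop 0] with n hn
    have hn' : (0 : ℝ) < n := Nat.cast_pos.2 hn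
    have h := (Nat.lt_floor_add_one ((n : ℝ) * t / T)).le
    rw [div_le_iff₀ hT] at h
    rw [le_div_iff₀ hn']
    linarith
  have hab : ∀ᶠ n in atTop, a n < b n := by
    filter_upwards [eventually_gt_atTop 0] with n hn
    rw [← sub_pos, hsub]
    exact div_pos hT (Nat.cast_pos.2 hn)
  have hlen : Tendsto (fun n : ℕ => T / n) atTop (𝓝 0) := tendsto_const_div_atTop_nhds_zero_nat T
  have ha : Tendsto a atTop (𝓝 t) := by
    refine tendsto_of_tendsto_of_tendsto_of_le_of_le'
      (by simpa using hlen.const_sub t) tendsto_const_nhds ?_ hat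
    filter_upwards [htb] with n hn
    linarith [hsub n]
  have hb : Tendsto b atTop (𝓝 t) := by
    refine tendsto_of_tendsto_of_tendsto_of_le_of_le'
      tendsto_const_nhds (by simpa using hlen.const_add t) htb ?_
    filter_upwards [hat] with n hn
    linarith [hsub n]
  have hd := hγ t (Ico_subset_Icc_self ht)
  have hlim := (continuous_cross.tendsto _).comp
    ((hd.continuousAt.tendsto.comp ha).prodMk_nhds (hd.tendsto_straddle ha hb hat htb hab))
  refine hlim.congr fun n => ?_
  simp only [Function.comp_apply, cross_smul_sub_self, hsub, inv_div]
  rfl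
end

section
/- Let γ : [0, T] → ℝ² be a C² curve with ‖γ′(t)‖ = 1 for all t, such that the areal density A(s) := γ(s) × γ′(s) is nonzero for all s ∈ [0, T], and let κ(t) := γ′(t) × γ″(t) be the signed curvature. Fix t ∈ (0, T) and for n set k_n := ⌊nt/T⌋, and for 0 ≤ j ≤ n−1 set e_n(j) := γ(jT/n) × γ((j+1)T/n). Then the (suitably normalized) angle elements of the LLS-sequence of the inscribed broken line with vertices γ(iT/n) converge pointwise to the angular density B(t) = −κ(t)/A(t)²: lim_{n→∞} (n/T)·((γ((k_n−1)T/n) − γ(k_n T/n)) × (γ((k_n+1)T/n) − γ(k_n T/n)))/(e_n(k_n−1)·e_n(k_n)) = −κ(t)/A(t)². -/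
open Filter Topology Set

/-- Edge elements of the LLS-sequence of the broken line inscribed in `γ : [0,T] → ℝ²`
with `n` edges: `e n j = γ (j T / n) × γ ((j+1) T / n)`. -/
noncomputable def edgeApprox (γ : ℝ → EuclideanSpace ℝ (Fin 2)) (T : ℝ) (n j : ℕ) : ℝ :=
  cross (γ ((j : ℝ) * T / n)) (γ (((j : ℝ) + 1) * T / n))

/-- Second-order Taylor expansion with Peano remainder for vector-valued functions. -/
theorem isLittleO_taylor_two {E : Type*} [NormedAddCommGroup E] [NormedSpace ℝ E]
    {f f' : ℝ → E} {c : E} {t : ℝ} (hf : ∀ᶠ x in 𝓝 t, HasDerivAt f (f' x) x)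
    (hf' : HasDerivAt f' c t) :
    (fun x => f x - f t - (x - t) • f' t - ((x - t) ^ 2 / 2) • c)
      =o[𝓝 t] fun x => (x - t) ^ 2 := by
  rw [Asymptotics.isLittleO_iff]
  intro ε hε
  have hd := (Asymptotics.isLittleO_iff.1 hf'.isLittleO) hε
  obtain ⟨δ, hδ, hball⟩ := Metric.eventually_nhds_iff.1 (hf.and hd)
  refine Metric.eventually_nhds_iff.2 ⟨δ, hδ, fun x hx => ?_⟩
  have hder : ∀ y ∈ Metric.closedBall t (dist x t), HasDerivWithinAt
      (fun x => f x - f t - (x - t) • f' t - ((x - t) ^ 2 / 2) • c)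
      (f' y - f' t - (y - t) • c) (Metric.closedBall t (dist x t)) y := by
    intro y hy
    have h₁ := (hball (lt_of_le_of_lt (Metric.mem_closedBall.1 hy) hx)).1
    have h₂ : HasDerivAt (fun x : ℝ => x - t) 1 y := (hasDerivAt_id y).sub_const t
    have h₃ : HasDerivAt (fun x : ℝ => (x - t) ^ 2 / 2) (y - t) y :=
      ((h₂.pow 2).div_const 2).congr_deriv (by simp)
    exact ((((h₁.sub_const (f t)).sub (h₂.smul_const (f' t))).sub
      (h₃.smul_const c)).congr_deriv (by simp)).hasDerivWithinAt
  have hbound : ∀ y ∈ Metric.closedBall t (dist x t),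
      ‖f' y - f' t - (y - t) • c‖ ≤ ε * dist x t := by
    intro y hy
    refine (hball (lt_of_le_of_lt (Metric.mem_closedBall.1 hy) hx)).2.trans ?_
    exact mul_le_mul_of_nonneg_left (Metric.mem_closedBall.1 hy) hε.le
  have hmv := (convex_closedBall t (dist x t)).norm_image_sub_le_of_norm_hasDerivWithin_le
    hder hbound (Metric.mem_closedBall_self dist_nonneg)
    (Metric.mem_closedBall.2 le_rfl : x ∈ Metric.closedBall t (dist x t))
  have hsq : ‖(x - t) ^ 2‖ = dist x t * ‖x - t‖ := by
    rw [norm_pow, Real.dist_eq, Real.norm_eq_abs, sq]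
  rw [hsq, ← mul_assoc]
  simpa using hmv

section Differences

variable {E ι : Type*} [NormedAddCommGroup E] [NormedSpace ℝ E] {l : Filter ι}
  {t : ℝ} {s h : ι → ℝ}

/-- Difference quotients over steps `h` based at points at distance `O(h)` from `t` converge to
the derivative at `t`. -/
theorem HasDerivAt.tendsto_moving_slope {f : ℝ → E} {f' : E} (hf : HasDerivAt f f' t)
    (hh : Tendsto h l (𝓝 0)) (hh0 : ∀ᶠ i in l, h i ≠ 0) (hs : (fun i => s i - t) =O[l] h) :
    Tendsto (fun i => (h i)⁻¹ • (f (s i + h i) - f (s i))) l (𝓝 f') := by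
  have hr : ∀ {x : ι → ℝ}, (fun i => x i - t) =O[l] h →
      (fun i => f (x i) - f t - (x i - t) • f') =o[l] h := fun {x} hx => by
    have hxt : Tendsto x l (𝓝 t) := by simpa using (hx.trans_tendsto hh).add_const t
    exact (hf.isLittleO.comp_tendsto hxt).trans_isBigO hx
  have hs' : (fun i => s i + h i - t) =O[l] h :=
    (hs.add (Asymptotics.isBigO_refl h l)).congr_left fun i => by ring
  have hdiff := (hr hs').sub (hr hs)
  have hz := hdiff.tendsto_inv_smul_nhds_zero
  refine (by simpa using hz.add_const f' : Tendsto _ l (𝓝 f')).congr' ?_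
  filter_upwards [hh0] with i hi
  match_scalars <;> field_simp <;> ring

/-- Symmetric second difference quotients with step `h` centred at points at distance `O(h)`
from `t` converge to the second derivative at `t`. -/
theorem tendsto_moving_second_difference {f f' : ℝ → E} {c : E}
    (hf : ∀ᶠ x in 𝓝 t, HasDerivAt f (f' x) x) (hf' : HasDerivAt f' c t)
    (hh : Tendsto h l (𝓝 0)) (hh0 : ∀ᶠ i in l, h i ≠ 0) (hs : (fun i => s i - t) =O[l] h) :
    Tendsto (fun i => (h i ^ 2)⁻¹ • ((f (s i + h i) - f (s i)) - (f (s i) - f (s i - h i))))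
      l (𝓝 c) := by
  have hr : ∀ {x : ι → ℝ}, (fun i => x i - t) =O[l] h →
      (fun i => f (x i) - f t - (x i - t) • f' t - ((x i - t) ^ 2 / 2) • c)
        =o[l] fun i => h i ^ 2 := fun {x} hx => by
    have hxt : Tendsto x l (𝓝 t) := by simpa using (hx.trans_tendsto hh).add_const t
    exact ((isLittleO_taylor_two hf hf').comp_tendsto hxt).trans_isBigO (hx.pow 2)
  have hp : (fun i => s i + h i - t) =O[l] h :=
    (hs.add (Asymptotics.isBigO_refl h l)).congr_left fun i => by ring
  have hm : (fun i => s i - h i - t) =O[l] h :=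
    (hs.sub (Asymptotics.isBigO_refl h l)).congr_left fun i => by ring
  have hdiff := ((hr hp).sub (hr hs)).sub ((hr hs).sub (hr hm))
  have hz := hdiff.tendsto_inv_smul_nhds_zero
  refine (by simpa using hz.add_const c : Tendsto _ l (𝓝 c)).congr' ?_
  filter_upwards [hh0] with i hi
  match_scalars <;> field_simp <;> ring

end Differences

theorem Filter.Tendsto.cross {ι : Type*} {l : Filter ι} {v w : ι → EuclideanSpace ℝ (Fin 2)}
    {a b : EuclideanSpace ℝ (Fin 2)} (hv : Tendsto v l (𝓝 a)) (hw : Tendsto w l (𝓝 b)) :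
    Tendsto (fun i => cross (v i) (w i)) l (𝓝 (cross a b)) := by
  have hc : Continuous fun p : EuclideanSpace ℝ (Fin 2) × EuclideanSpace ℝ (Fin 2) =>
      _root_.cross p.1 p.2 := by
    unfold _root_.cross
    fun_prop
  exact (hc.tendsto (a, b)).comp (hv.prodMk_nhds hw)

/-- The normalized angle element of three points of the plane, in terms of difference quotients. -/
theorem angle_element_eq (a b c : EuclideanSpace ℝ (Fin 2)) {h : ℝ} (hh : h ≠ 0) :
    -cross (h⁻¹ • (b - a)) ((h ^ 2)⁻¹ • ((c - b) - (b - a))) /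
        (cross a (h⁻¹ • (b - a)) * cross b (h⁻¹ • (c - b))) =
      h⁻¹ * (cross (a - b) (c - b) / (cross a b * cross b c)) := by
  have h₁ : cross a (h⁻¹ • (b - a)) = h⁻¹ * cross a b := by simp [cross]; ring
  have h₂ : cross b (h⁻¹ • (c - b)) = h⁻¹ * cross b c := by simp [cross]; ring
  have h₃ : -cross (h⁻¹ • (b - a)) ((h ^ 2)⁻¹ • ((c - b) - (b - a))) =
      h⁻¹ * (h ^ 2)⁻¹ * cross (a - b) (c - b) := by simp [cross]; ring
  rw [h₁, h₂, h₃]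
  field_simp

/-- **Convergence of angle elements of inscribed broken lines to the angular density.**
Let `γ : [0,T] → ℝ²` be a unit-speed `C²` curve with nonvanishing areal density
`A s = γ s × γ' s` and signed curvature `κ t = γ' t × γ'' t`.  For `t ∈ (0,T)` and
`kₙ = ⌊n t / T⌋`, the normalized angle elements of the LLS-sequence of the inscribed broken
line with vertices `γ (i T / n)` converge to the angular density `B t = -κ t / (A t)²`:
`(n/T) · ((γ ((kₙ-1) T/n) - γ (kₙ T/n)) × (γ ((kₙ+1) T/n) - γ (kₙ T/n)))
  / (e n (kₙ-1) · e n kₙ) → -κ t / (A t)²`. -/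
theorem angle_elements_tendsto_angular_density
    (T : ℝ) (hT : 0 < T) (γ γ' γ'' : ℝ → EuclideanSpace ℝ (Fin 2))
    (hγ : ∀ t ∈ Icc 0 T, HasDerivAt γ (γ' t) t)
    (hγ' : ∀ t ∈ Icc 0 T, HasDerivAt γ' (γ'' t) t)
    (hcont : ContinuousOn γ'' (Icc 0 T))
    (hunit : ∀ t ∈ Icc 0 T, ‖γ' t‖ = 1)
    (hA : ∀ s ∈ Icc 0 T, cross (γ s) (γ' s) ≠ 0) :
    ∀ t ∈ Ioo 0 T,
      Tendsto (fun n : ℕ =>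
          (n / T) *
            (cross (γ (((⌊(n : ℝ) * t / T⌋₊ - 1 : ℕ) : ℝ) * T / n)
                      - γ ((⌊(n : ℝ) * t / T⌋₊ : ℝ) * T / n))
                   (γ (((⌊(n : ℝ) * t / T⌋₊ : ℝ) + 1) * T / n)
                      - γ ((⌊(n : ℝ) * t / T⌋₊ : ℝ) * T / n))
              / (edgeApprox γ T n (⌊(n : ℝ) * t / T⌋₊ - 1) *
                 edgeApprox γ T n ⌊(n : ℝ) * t / T⌋₊)))
        atTop (𝓝 (-(cross (γ' t) (γ'' t)) / (cross (γ t) (γ' t)) ^ 2)) := by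
  intro t ht
  have htI : t ∈ Icc 0 T := Ioo_subset_Icc_self ht
  set h : ℕ → ℝ := fun n => T / n with h_def
  set s : ℕ → ℝ := fun n => (⌊(n : ℝ) * t / T⌋₊ : ℝ) * T / n with s_def
  have hpos : ∀ᶠ n : ℕ in atTop, (0 : ℝ) < n := by
    filter_upwards [eventually_gt_atTop 0] with n hn using Nat.cast_pos.2 hn
  have hh : Tendsto h atTop (𝓝 0) := tendsto_const_div_atTop_nhds_zero_nat T
  have hh0 : ∀ᶠ n in atTop, h n ≠ 0 := hpos.mono fun n hn => (div_pos hT hn).ne'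
  have hs : (fun n => s n - t) =O[atTop] h := by
    refine Asymptotics.IsBigO.of_bound 1 (hpos.mono fun n hn => ?_)
    have hfl : 0 ≤ (n : ℝ) * t / T := div_nonneg (mul_nonneg hn.le ht.1.le) hT.le
    have hlo := Nat.floor_le hfl
    have hhi := Nat.lt_floor_add_one ((n : ℝ) * t / T)
    have hst : s n - t = (⌊(n : ℝ) * t / T⌋₊ - (n : ℝ) * t / T) * h n := by
      simp only [s_def, h_def]
      field_simp
    rw [hst, norm_mul]
    refine mul_le_mul_of_nonneg_right ?_ (norm_nonneg _)
    rw [Real.norm_eq_abs, abs_le]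
    constructor <;> linarith
  have hsm : (fun n => s n - h n - t) =O[atTop] h :=
    (hs.sub (Asymptotics.isBigO_refl h atTop)).congr_left fun n => by ring
  have htend : ∀ {x : ℕ → ℝ}, (fun n => x n - t) =O[atTop] h →
      Tendsto (fun n => γ (x n)) atTop (𝓝 (γ t)) := fun {x} hx =>
    (hγ t htI).continuousAt.tendsto.comp (by simpa using (hx.trans_tendsto hh).add_const t)
  have hq := (hγ t htI).tendsto_moving_slope hh hh0 hs
  have hp := (hγ t htI).tendsto_moving_slope hh hh0 hsm
  have hpq := tendsto_moving_second_difference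
    (mem_of_superset (Icc_mem_nhds ht.1 ht.2) hγ)
    (hγ' t htI) hh hh0 hs
  simp only [sub_add_cancel] at hp
  have hlim := (hp.cross hpq).neg.div (((htend hsm).cross hp).mul ((htend hs).cross hq))
    (mul_ne_zero (hA t htI) (hA t htI))
  rw [← sq] at hlim
  have hk : ∀ᶠ n : ℕ in atTop, 1 ≤ ⌊(n : ℝ) * t / T⌋₊ := by
    have hgrow : Tendsto (fun n : ℕ => (n : ℝ) * t / T) atTop atTop :=
      (tendsto_natCast_atTop_atTop.atTop_mul_const ht.1).atTop_div_const hT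
    filter_upwards [hgrow.eventually_ge_atTop 1] with n hn
    exact (Nat.one_le_floor_iff _).2 hn
  refine hlim.congr' ?_
  filter_upwards [hh0, hk] with n hn hkn
  have hprev : (((⌊(n : ℝ) * t / T⌋₊ - 1 : ℕ) : ℝ)) * T / n = s n - h n := by
    rw [Nat.cast_sub hkn]
    simp only [s_def, h_def]
    push_cast
    ring
  have hcur : (((⌊(n : ℝ) * t / T⌋₊ - 1 : ℕ) : ℝ) + 1) * T / n = s n := by
    rw [Nat.cast_sub hkn]
    simp [s_def]
  have hnext : ((⌊(n : ℝ) * t / T⌋₊ : ℝ) + 1) * T / n = s n + h n := by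
    simp only [s_def, h_def]
    ring
  have hinv : (n : ℝ) / T = (h n)⁻¹ := by simp [h_def]
  simp only [Pi.div_apply, edgeApprox]
  rw [hprev, hcur, hnext, hinv]
  exact angle_element_eq _ _ _ hn
end

section
/- Let a > 0 and b ∈ ℝ, and let γ(u) := (a e^{bu} cos u, a e^{bu} sin u) parametrize a logarithmic spiral. Then the areal density of γ with respect to arclength and the origin satisfies A(u) = a e^{bu}/√(b² + 1) for all u, and moreover A(u)·κ(u) = 1/(b² + 1) for all u, where κ(u) = (γ′(u) × γ″(u))/‖γ′(u)‖³ is the curvature; equivalently, the product A³B of the cube of the areal density with the angular density is the constant function 1/(b² + 1). -/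
open Real

/-- The point of the Euclidean plane with coordinates `(x, y)`. -/
noncomputable def pt (x y : ℝ) : EuclideanSpace ℝ (Fin 2) :=
  (WithLp.equiv 2 (Fin 2 → ℝ)).symm ![x, y]

theorem hasDerivAt_pt {f g : ℝ → ℝ} {f' g' u : ℝ} (hf : HasDerivAt f f' u)
    (hg : HasDerivAt g g' u) : HasDerivAt (fun v => pt (f v) (g v)) (pt f' g') u := by
  have h : HasDerivAt (fun v => ![f v, g v]) ![f', g'] u := by
    rw [hasDerivAt_pi]
    intro i
    fin_cases i
    · exact hf
    · exact hg
  exact (PiLp.hasFDerivAt_toLp (𝕜 := ℝ) 2 ![f u, g u]).comp_hasDerivAt u h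

theorem norm_pt (x y : ℝ) : ‖pt x y‖ = √(x ^ 2 + y ^ 2) := by
  simp [pt, EuclideanSpace.norm_eq]

theorem cross_pt (x y z w : ℝ) : cross (pt x y) (pt z w) = x * w - y * z := by
  simp [pt, cross]

/-- The image of the point `(p, q)` under rotation by `u` and scaling by `e^{bu}`. -/
noncomputable def spiral (b p q u : ℝ) : EuclideanSpace ℝ (Fin 2) :=
  pt (exp (b * u) * (p * cos u - q * sin u)) (exp (b * u) * (p * sin u + q * cos u))

theorem deriv_spiral (b p q : ℝ) :
    deriv (spiral b p q) = spiral b (b * p - q) (p + b * q) := by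
  funext u
  have he : HasDerivAt (fun v => exp (b * v)) (exp (b * u) * b) u := by
    simpa using ((hasDerivAt_id u).const_mul b).exp
  have hc := hasDerivAt_cos u
  have hs := hasDerivAt_sin u
  refine (hasDerivAt_pt (he.mul ((hc.const_mul p).sub (hs.const_mul q)))
    (he.mul ((hs.const_mul p).add (hc.const_mul q)))).deriv.trans ?_
  rw [spiral]
  congr 1 <;> simp only [Pi.add_apply, Pi.sub_apply] <;> ring

theorem norm_spiral (b p q u : ℝ) :
    ‖spiral b p q u‖ = exp (b * u) * √(p ^ 2 + q ^ 2) := by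
  rw [spiral, norm_pt, ← Real.sqrt_sq (exp_pos (b * u)).le, ← Real.sqrt_mul (sq_nonneg _),
    Real.sqrt_sq (exp_pos (b * u)).le]
  congr 1
  linear_combination exp (b * u) ^ 2 * (p ^ 2 + q ^ 2) * sin_sq_add_cos_sq u

theorem cross_spiral (b p q r s u : ℝ) :
    cross (spiral b p q u) (spiral b r s u) = exp (b * u) ^ 2 * (p * s - q * r) := by
  rw [spiral, spiral, cross_pt]
  linear_combination exp (b * u) ^ 2 * (p * s - q * r) * sin_sq_add_cos_sq u

/-- **Areal and angular densities of a logarithmic spiral.**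
For the logarithmic spiral `γ u = (a e^{bu} cos u, a e^{bu} sin u)` (`a > 0`) and the origin,
the areal density with respect to arclength is `A u = a e^{bu} / √(b² + 1)`, and
`A · κ = 1 / (b² + 1)` where `κ` is the curvature; equivalently, the product `A³ B` of the
cube of the areal density with the angular density `B = κ / A²` is the constant
`1 / (b² + 1)`. -/
theorem log_spiral_densities
    (a b : ℝ) (ha : 0 < a)
    (γ : ℝ → EuclideanSpace ℝ (Fin 2))
    (hγ : γ = fun u => pt (a * exp (b * u) * cos u) (a * exp (b * u) * sin u))
    (A κ : ℝ → ℝ)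
    (hA : ∀ u, A u = cross (γ u) (deriv γ u) / ‖deriv γ u‖)
    (hκ : ∀ u, κ u = cross (deriv γ u) (deriv (deriv γ) u) / ‖deriv γ u‖ ^ 3) :
    ∀ u, A u = a * exp (b * u) / Real.sqrt (b ^ 2 + 1) ∧
      A u * κ u = 1 / (b ^ 2 + 1) := by
  have hspiral : γ = spiral b a 0 := by
    rw [hγ]
    funext u
    rw [spiral]
    congr 1 <;> ring
  intro u
  have he := exp_pos (b * u)
  have hb : 0 < √(b ^ 2 + 1) := by positivity
  have hsq : √(b ^ 2 + 1) ^ 2 = b ^ 2 + 1 := Real.sq_sqrt (by positivity)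
  have hnorm : ‖deriv γ u‖ = exp (b * u) * (a * √(b ^ 2 + 1)) := by
    rw [hspiral, deriv_spiral, norm_spiral,
      show (b * a - 0) ^ 2 + (a + b * 0) ^ 2 = a ^ 2 * (b ^ 2 + 1) by ring,
      Real.sqrt_mul (sq_nonneg a), Real.sqrt_sq ha.le]
  have hAu : A u = a * exp (b * u) / √(b ^ 2 + 1) := by
    rw [hA, hnorm, hspiral, deriv_spiral, cross_spiral]
    field_simp
    ring
  have hκu : κ u = 1 / (a * exp (b * u) * √(b ^ 2 + 1)) := by
    rw [hκ, hnorm, hspiral, deriv_spiral, deriv_spiral, cross_spiral]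
    field_simp
    rw [hsq]
    ring
  refine ⟨hAu, ?_⟩
  rw [hAu, hκu]
  field_simp
  exact hsq.symm
end
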